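/- Let w ∈ S∞, let n be a positive integer, and let φ be a non-standard flag. Let i be the smallest positive integer with φ(i) > i and set j = φ(i) − 1. If i > n or j ≥ n, then RFC_n(w,φ) = RFC_n(w, φ−e_i). Otherwise, RFC_n(w,φ) = 𝔇_j RFC_n(w, φ−e_i), where 𝔇_j is the j-th Demazure operator on subsets of the Morse–Schilling crystal RF_n(w). -/

import Mathlib

noncomputable section
attribute [local instance] Classical.propDecidable

/-! ### Words, permutations, reduced words -/

/-- The adjacent transposition `s_i` exchanging `i` and `i+1`. -/
def sPerm (i : ℕ) : Equiv.Perm ℕ := Equiv.swap i (i + 1)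

/-- The permutation `s_{i_1} ⋯ s_{i_n}` represented by the word `i_1 ⋯ i_n`. -/
def wordPerm (ρ : List ℕ) : Equiv.Perm ℕ := (ρ.map sPerm).prod

/-- A word whose letters are positive integers. -/
def PosWord (ρ : List ℕ) : Prop := ∀ x ∈ ρ, 1 ≤ x

/-- A reduced word: a word of positive integers of minimal length among all words of
positive integers representing the same permutation. -/
def IsReducedWord (ρ : List ℕ) : Prop :=
  PosWord ρ ∧ ∀ σ : List ℕ, PosWord σ → wordPerm σ = wordPerm ρ → ρ.length ≤ σ.length

/-- `ρ` is a reduced word for the permutation `w`. -/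
def IsReducedWordFor (w : Equiv.Perm ℕ) (ρ : List ℕ) : Prop :=
  IsReducedWord ρ ∧ wordPerm ρ = w

/-- A member of `S∞`: a permutation of the positive integers (it fixes `0`)
fixing all but finitely many points. -/
def FinitaryPerm (w : Equiv.Perm ℕ) : Prop := w 0 = 0 ∧ {i : ℕ | w i ≠ i}.Finite

/-- A flag: a weakly increasing function `φ : ℤ_{>0} → ℤ_{>0}` with `φ(n) ≥ n`. -/
def IsFlag (φ : ℕ → ℕ) : Prop :=
  (∀ m n : ℕ, 1 ≤ m → m ≤ n → φ m ≤ φ n) ∧ ∀ n : ℕ, 1 ≤ n → n ≤ φ n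

/-- A weak composition, as a function on the positive integers (value `0` at `0`)
with finitely many nonzero entries. -/
def WeakComp (α : ℕ → ℕ) : Prop := α 0 = 0 ∧ {i : ℕ | α i ≠ 0}.Finite

/-- `φ - e_i`, i.e. `l ↦ φ(l) - δ_{il}`. -/
def subE (φ : ℕ → ℕ) (i : ℕ) : ℕ → ℕ := fun l => if l = i then φ l - 1 else φ l

/-- The right action of `s_i` on weak compositions, swapping entries `i` and `i+1`. -/
def swapC (α : ℕ → ℕ) (i : ℕ) : ℕ → ℕ := fun j => α (sPerm i j)

/-- `α` has length `k`: `k` is minimal with `α i = 0` for all `i > k`. -/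
def HasLen (α : ℕ → ℕ) (k : ℕ) : Prop :=
  (∀ i, k < i → α i = 0) ∧ ∀ m, (∀ i, m < i → α i = 0) → k ≤ m

/-! ### Coxeter–Knuth equivalence -/

/-- One Coxeter–Knuth move. -/
def CKStep (u v : List ℕ) : Prop :=
  (∃ (a b : List ℕ) (x y z : ℕ), y < x ∧ x < z ∧
      u = a ++ [x, y, z] ++ b ∧ v = a ++ [x, z, y] ++ b) ∨
  (∃ (a b : List ℕ) (x y z : ℕ), y < z ∧ z < x ∧
      u = a ++ [x, y, z] ++ b ∧ v = a ++ [y, x, z] ++ b) ∨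
  (∃ (a b : List ℕ) (i : ℕ),
      u = a ++ [i, i + 1, i] ++ b ∧ v = a ++ [i + 1, i, i + 1] ++ b)

/-- Coxeter–Knuth equivalence: the transitive (symmetric, reflexive) closure of `CKStep`. -/
def CKEquiv : List ℕ → List ℕ → Prop := Relation.EqvGen CKStep

/-! ### Run factorizations and weak descent tableaux -/

/-- The run factorization of a word into maximal strictly increasing blocks
(listed from left to right). -/
def runFact : List ℕ → List (List ℕ)
  | [] => []
  | a :: rest =>
    match runFact rest with
    | [] => [[a]]
    | r :: rs => if a < r.headI then (a :: r) :: rs else [a] :: r :: rs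

/-- Auxiliary: rows of the remaining blocks, given the row of the previous block. -/
def wdtRowsAux : ℤ → List (List ℕ) → List ℤ
  | _, [] => []
  | prev, b :: bs =>
      min (prev - 1) (b.headI : ℤ) :: wdtRowsAux (min (prev - 1) (b.headI : ℤ)) bs

/-- The row indices assigned to the blocks of a run factorization (blocks listed
left to right): the leftmost block goes to the row indexed by its first letter, and each
subsequent block goes to the row indexed by its first letter if this is below the previous
block's row, and otherwise directly below the previous block's row. -/
def wdtRows : List (List ℕ) → List ℤ
  | [] => []
  | b :: bs => (b.headI : ℤ) :: wdtRowsAux (b.headI : ℤ) bs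

/-- A tableau: rows indexed by `ℤ` (bottom to top), columns indexed by `ℕ` starting at `1`;
the value `0` means that there is no box, a nonzero value is the (positive) entry. -/
abbrev Tableau := ℤ → ℕ → ℕ

/-- The weak descent tableau of a word. -/
def weakDesTab (ρ : List ℕ) : Tableau := fun r c =>
  if c = 0 then 0
  else
    match ((wdtRows (runFact ρ)).zip (runFact ρ)).find? (fun p => decide (p.1 = r)) with
    | some p => p.2.getD (c - 1) 0
    | none => 0

/-- A word is non-virtual if its weak descent tableau only occupies rows of positive index. -/
def NonVirtual (ρ : List ℕ) : Prop := ∀ r ∈ wdtRows (runFact ρ), 1 ≤ r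

/-- The shape of a tableau: the number of boxes in each (positively indexed) row. -/
def shapeOf (T : Tableau) : ℕ → ℕ := fun i => Set.ncard {c : ℕ | T (i : ℤ) c ≠ 0}

/-- The weak descent composition of a word: the shape of its weak descent tableau. -/
def desComp (ρ : List ℕ) : ℕ → ℕ := shapeOf (weakDesTab ρ)

/-- Partial-sum (dominance) order on weak compositions. -/
def compLE (μ ν : ℕ → ℕ) : Prop :=
  ∀ k : ℕ, ∑ i ∈ Finset.Icc 1 k, μ i ≤ ∑ i ∈ Finset.Icc 1 k, ν i

/-- A Yamanouchi reduced word: a non-virtual reduced word that is minimal in its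
Coxeter–Knuth class among non-virtual words, for the order
`ρ ≤ τ ↔ ρ ~ τ ∧ des ρ ≤ des τ`. -/
def Yamanouchi (ρ : List ℕ) : Prop :=
  IsReducedWord ρ ∧ NonVirtual ρ ∧
    ∀ σ : List ℕ, NonVirtual σ → CKEquiv ρ σ → compLE (desComp ρ) (desComp σ)

/-- The (unique) Yamanouchi reduced word Coxeter–Knuth equivalent to `ρ`. -/
def hatRho (ρ : List ℕ) : List ℕ :=
  if h : ∃ σ, Yamanouchi σ ∧ CKEquiv ρ σ then h.choose else []

/-- The weak Edelman–Greene insertion tableau of a word: the weak descent tableau of the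
unique Yamanouchi reduced word Coxeter–Knuth equivalent to it. -/
def hatP (ρ : List ℕ) : Tableau := weakDesTab (hatRho ρ)

/-! ### Factorizations -/

/-- The factorization `f : ℕ → List ℕ` stores the block `ρ^{(i)}` at index `i ≥ 1`
(blocks indexed from the right); the largest index of a nonempty block. -/
def topIdx (f : ℕ → List ℕ) : ℕ := sSup {i : ℕ | f i ≠ []}

/-- The concatenation `ρ^{(top)} ⋯ ρ^{(i+1)} ρ^{(i)}` of the blocks of `f` with index `≥ i`. -/
def factWordGe (f : ℕ → List ℕ) (i : ℕ) : List ℕ :=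
  ((((List.range (topIdx f + 1)).reverse).filter (fun j => decide (i ≤ j))).map f).foldr
    (· ++ ·) []

/-- The underlying word of a factorization. -/
def factWord (f : ℕ → List ℕ) : List ℕ := factWordGe f 0

/-- The weak Edelman–Greene recording tableau of a factorization: it has the same shape as
the weak EG insertion tableau of the underlying word, and has entry `i` in all boxes of
`P̂(ρ^{(k)}|⋯|ρ^{(i)})` that are not in `P̂(ρ^{(k)}|⋯|ρ^{(i+1)})`. -/
def hatQfact (f : ℕ → List ℕ) : Tableau := fun r c =>
  sSup {i : ℕ | 1 ≤ i ∧ hatP (factWordGe f i) r c ≠ 0 ∧ hatP (factWordGe f (i + 1)) r c = 0}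

/-- Every block is strictly increasing. -/
def IncreasingFact (f : ℕ → List ℕ) : Prop := ∀ i, List.Chain' (· < ·) (f i)

/-- The factorization is `φ`-flagged: every nonempty block `ρ^{(i)}` has first letter
`ρ^{(i)}_1` with `φ(ρ^{(i)}_1) ≥ i`. -/
def FlaggedFact (φ : ℕ → ℕ) (f : ℕ → List ℕ) : Prop :=
  ∀ i, f i ≠ [] → i ≤ φ ((f i).headI)

/-- `RFC(w, φ)`: all `φ`-flagged increasing factorizations of reduced words for `w`. -/
def RFCset (w : Equiv.Perm ℕ) (φ : ℕ → ℕ) : Set (ℕ → List ℕ) :=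
  {f | f 0 = [] ∧ {i : ℕ | f i ≠ []}.Finite ∧ IncreasingFact f ∧ FlaggedFact φ f ∧
       IsReducedWordFor w (factWord f)}

/-- `RF_n(w)`: increasing factorizations of reduced words for `w` with exactly `n` blocks
(indexed `1, …, n`, possibly empty). -/
def RFn (n : ℕ) (w : Equiv.Perm ℕ) : Set (ℕ → List ℕ) :=
  {f | f 0 = [] ∧ (∀ j, n < j → f j = []) ∧ IncreasingFact f ∧
       IsReducedWordFor w (factWord f)}

/-- `RFC_n(w, φ)`: the `φ`-flagged elements of `RF_n(w)`. -/
def RFCn (n : ℕ) (w : Equiv.Perm ℕ) (φ : ℕ → ℕ) : Set (ℕ → List ℕ) :=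
  {f | f ∈ RFn n w ∧ FlaggedFact φ f}

/-! ### Morse–Schilling crystal operators -/

/-- Pairing procedure: first argument is the block `r^{(i)}` in *decreasing* order, second is
the not-yet-paired part of the block `r^{(i+1)}` (in increasing order). Each letter `b` of
`r^{(i)}`, from largest to smallest, is paired with the smallest still unpaired letter of
`r^{(i+1)}` strictly larger than `b`. Returns the unpaired letters of `r^{(i+1)}`. -/
def unpairedUpper : List ℕ → List ℕ → List ℕ
  | [], A => A
  | b :: bs, A =>
    match A.find? (fun a => decide (b < a)) with
    | some a => unpairedUpper bs (A.erase a)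
    | none => unpairedUpper bs A

/-- As in `unpairedUpper`, but returns the unpaired letters of `r^{(i)}`. -/
def unpairedLower : List ℕ → List ℕ → List ℕ
  | [], _ => []
  | b :: bs, A =>
    match A.find? (fun a => decide (b < a)) with
    | some a => unpairedLower bs (A.erase a)
    | none => b :: unpairedLower bs A

/-- Insert a letter into a weakly increasing list, keeping it increasing. -/
def insAsc (x : ℕ) : List ℕ → List ℕ
  | [] => [x]
  | y :: ys => if x ≤ y then x :: y :: ys else y :: insAsc x ys

/-- The Morse–Schilling raising operator `e_i`: if every letter of block `i+1` is paired,
the result is `none` (i.e. `0`); otherwise the largest unpaired letter `a` of block `i+1` is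
removed and `a + s` is added to block `i`, where `s = min {j ≥ 0 | a+j+1 ∉ r^{(i+1)}}`. -/
def msE (i : ℕ) (f : ℕ → List ℕ) : Option (ℕ → List ℕ) :=
  let B := f i
  let A := f (i + 1)
  let L := unpairedUpper B.reverse A
  if L = [] then none
  else
    let a := L.foldr max 0
    let s := sInf {j : ℕ | (a + j + 1) ∉ A}
    some (Function.update (Function.update f (i + 1) (A.erase a)) i (insAsc (a + s) B))

/-- The Morse–Schilling lowering operator `f_i`: if every letter of block `i` is paired,
the result is `none`; otherwise the smallest unpaired letter `b` of block `i` is removed and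
`b - t` is added to block `i+1`, where `t = min {j ≥ 0 | b-j-1 ∉ r^{(i)}}`. -/
def msF (i : ℕ) (f : ℕ → List ℕ) : Option (ℕ → List ℕ) :=
  let B := f i
  let A := f (i + 1)
  let R := unpairedLower B.reverse A
  if R = [] then none
  else
    let b := R.foldr min R.headI
    let t := sInf {j : ℕ | (b - j - 1) ∉ B}
    some (Function.update (Function.update f i (B.erase b)) (i + 1) (insAsc (b - t) A))

/-- Iteration `e_j^k` of the raising operator. -/
def msEIter (j : ℕ) : ℕ → (ℕ → List ℕ) → Option (ℕ → List ℕ)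
  | 0, f => some f
  | k + 1, f => (msE j f).bind (msEIter j k)

/-- The Demazure operator `𝔇_j` on subsets of the crystal `RF_n(w)`:
`𝔇_j X = {b ∈ RF_n(w) | e_j^k(b) ∈ X for some k ≥ 0}`. -/
def demOp (n : ℕ) (w : Equiv.Perm ℕ) (j : ℕ) (X : Set (ℕ → List ℕ)) : Set (ℕ → List ℕ) :=
  {b | b ∈ RFn n w ∧ ∃ (k : ℕ) (c : ℕ → List ℕ), msEIter j k b = some c ∧ c ∈ X}

/-- `𝔇_{i_1} 𝔇_{i_2} ⋯ 𝔇_{i_k} X` for a word `i_1 i_2 ⋯ i_k` (the head is applied last). -/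
def demWord (n : ℕ) (w : Equiv.Perm ℕ) : List ℕ → Set (ℕ → List ℕ) → Set (ℕ → List ℕ)
  | [], X => X
  | j :: rest, X => demOp n w j (demWord n w rest X)

/-- `𝔇_{b↓a} = 𝔇_{b-1} 𝔇_{b-2} ⋯ 𝔇_a` (the identity when `b ≤ a`). -/
def demDown (n : ℕ) (w : Equiv.Perm ℕ) (b a : ℕ) (X : Set (ℕ → List ℕ)) :
    Set (ℕ → List ℕ) :=
  demWord n w ((List.range' a (b - a)).reverse) X

/-! ### Key tableaux -/

/-- A key tableau: a filling of a left-justified diagram in the positively indexed rows,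
with positive entries, weakly decreasing rows, distinct column entries, and the key
condition (c) of Assaf–Schilling. -/
def IsKeyTableau (T : Tableau) : Prop :=
  (∀ (r : ℤ) (c : ℕ), r ≤ 0 → T r c = 0) ∧
  (∀ r : ℤ, T r 0 = 0) ∧
  {p : ℤ × ℕ | T p.1 p.2 ≠ 0}.Finite ∧
  (∀ (r : ℤ) (c : ℕ), 1 ≤ c → T r (c + 1) ≠ 0 → T r c ≠ 0) ∧
  (∀ (r : ℤ) (c : ℕ), 1 ≤ c → T r (c + 1) ≠ 0 → T r (c + 1) ≤ T r c) ∧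
  (∀ (r r' : ℤ) (c : ℕ), r ≠ r' → T r c ≠ 0 → T r' c ≠ 0 → T r c ≠ T r' c) ∧
  (∀ (r r' : ℤ) (c : ℕ), r < r' → T r c ≠ 0 → T r' c ≠ 0 → T r' c < T r c →
      T r (c + 1) ≠ 0 ∧ T r' c < T r (c + 1))

/-- The tableau is `φ`-flagged: every entry in row `i` is at most `φ(i)`. -/
def FlaggedTab (φ : ℕ → ℕ) (T : Tableau) : Prop := ∀ (i c : ℕ), T (i : ℤ) c ≤ φ i

/-- `SSKT(α, φ)`: the `φ`-flagged key tableaux of shape `α`. -/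
def SSKT (α φ : ℕ → ℕ) : Set Tableau :=
  {T | IsKeyTableau T ∧ shapeOf T = α ∧ FlaggedTab φ T}

/-- The weight of a tableau: `wt(T)_v` is the number of entries equal to `v`. -/
def wtTab (T : Tableau) : ℕ → ℕ := fun v =>
  if v = 0 then 0 else Set.ncard {p : ℤ × ℕ | T p.1 p.2 = v}

/-- The weight of a word: the multiplicity of each positive letter. -/
def wtWord (u : List ℕ) : ℕ → ℕ := fun v => if v = 0 then 0 else u.count v

/-- The statistic `m_i(col(T), j)` where position `j` of the reverse column reading word
(entries read down columns, from right to left) is the box in row `r`, column `c`: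
the number of entries `i+1` weakly after this box minus the number of entries `i`. -/
def mi (T : Tableau) (i : ℕ) (r : ℤ) (c : ℕ) : ℤ :=
  (Set.ncard {p : ℤ × ℕ | T p.1 p.2 = i + 1 ∧ (p.2 < c ∨ (p.2 = c ∧ p.1 ≤ r))} : ℤ) -
  (Set.ncard {p : ℤ × ℕ | T p.1 p.2 = i ∧ (p.2 < c ∨ (p.2 = c ∧ p.1 ≤ r))} : ℤ)

/-- The box `(r, c)` maximizes `m_i` among all boxes of `T`. -/
def isMaxBox (T : Tableau) (i : ℕ) (r : ℤ) (c : ℕ) : Prop :=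
  T r c ≠ 0 ∧ ∀ (r' : ℤ) (c' : ℕ), T r' c' ≠ 0 → mi T i r' c' ≤ mi T i r c

/-- The Assaf–Schilling raising operator `e_i` on key tableaux.  If `m_i(col(T)) ≤ 0` the
result is `none` (i.e. `0`); otherwise, with `q` the largest position of the reverse column
reading word achieving the maximum (i.e. the maximizing box with the smallest column index,
and the smallest row index in that column), all entries `i+1` in the row of `q` weakly to its
right are changed to `i`, and all entries `i` in the same columns as these entries are
changed to `i+1`. -/
def keyE (i : ℕ) (T : Tableau) : Option Tableau :=
  if h : ∃ (r : ℤ) (c : ℕ), isMaxBox T i r c ∧ 1 ≤ mi T i r c then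
    let cq := sInf {c : ℕ | ∃ r : ℤ, isMaxBox T i r c}
    let rq : ℤ := ((sInf {m : ℕ | isMaxBox T i ((m : ℕ) : ℤ) cq} : ℕ) : ℤ)
    some (fun r c =>
      if cq ≤ c ∧ T rq c = i + 1 then
        (if T r c = i + 1 then i else if T r c = i then i + 1 else T r c)
      else T r c)
  else none

/-- The Assaf–Schilling lowering operator `f_i`: the (unique) inverse of `e_i`. -/
def keyF (i : ℕ) (T : Tableau) : Option Tableau :=
  if h : ∃ T', keyE i T' = some T then some h.choose else none

/-- Restriction of a partially defined crystal operator to a subset: the operator returns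
`none` (i.e. `0`) whenever it would leave the subset. -/
def restrictOp {β : Type} (S : Set β) (op : β → Option β) (x : β) : Option β :=
  (op x).bind fun y => if y ∈ S then some y else none

/-! ### Polynomials: divided differences and key polynomials -/

/-- The divided difference operator `∂_i f = (f - s_i · f) / (x_i - x_{i+1})`. -/
def divDiff (i : ℕ) (fp : MvPolynomial ℕ ℤ) : MvPolynomial ℕ ℤ :=
  if h : ∃ g : MvPolynomial ℕ ℤ,
      g * (MvPolynomial.X i - MvPolynomial.X (i + 1)) =
        fp - MvPolynomial.rename (fun j => sPerm i j) fp
  then h.choose else 0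

/-- The isobaric divided difference operator `π_i f = ∂_i (x_i f)`. -/
def piOp (i : ℕ) (fp : MvPolynomial ℕ ℤ) : MvPolynomial ℕ ℤ :=
  divDiff i (MvPolynomial.X i * fp)

/-- `π_{i_1} π_{i_2} ⋯ π_{i_k} f` for a word `i_1 i_2 ⋯ i_k` (the head is applied last). -/
def piWord : List ℕ → MvPolynomial ℕ ℤ → MvPolynomial ℕ ℤ
  | [], fp => fp
  | i :: rest, fp => piOp i (piWord rest fp)

/-- `π_{b↓a} = π_{b-1} π_{b-2} ⋯ π_a` (the identity when `b ≤ a`). -/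
def piDown (b a : ℕ) (fp : MvPolynomial ℕ ℤ) : MvPolynomial ℕ ℤ :=
  piWord ((List.range' a (b - a)).reverse) fp

/-- The conjugate of a weak composition: `conjC α t = #{j ≥ 1 | α_j ≥ t}` for `t ≥ 1`. -/
def conjC (α : ℕ → ℕ) (t : ℕ) : ℕ :=
  Set.ncard {j : ℕ | 1 ≤ j ∧ 1 ≤ t ∧ t ≤ α j}

/-- The partition rearrangement of a weak composition (the conjugate of its conjugate). -/
def sortC (α : ℕ → ℕ) : ℕ → ℕ := conjC (conjC α)

/-- The length of a permutation: the common length of its reduced words. -/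
def permLength (w : Equiv.Perm ℕ) : ℕ :=
  sInf {n : ℕ | ∃ ρ : List ℕ, PosWord ρ ∧ wordPerm ρ = w ∧ ρ.length = n}

/-- The monomial `x^β = x_1^{β_1} x_2^{β_2} ⋯`. -/
def xExp (β : ℕ → ℕ) : MvPolynomial ℕ ℤ :=
  ∏ i ∈ Finset.range (sSup {n : ℕ | β n ≠ 0} + 1), MvPolynomial.X i ^ β i

/-- The key polynomial `κ_α = π_w x^λ` where `λ` is the partition rearrangement of `α` and
`w` is the minimal-length permutation of `S∞` with `α · w = λ`. -/
def keyPoly (α : ℕ → ℕ) : MvPolynomial ℕ ℤ :=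
  if h : ∃ (ρ : List ℕ) (w : Equiv.Perm ℕ), IsReducedWordFor w ρ ∧
      (∀ i, α (w i) = sortC α i) ∧
      (∀ v : Equiv.Perm ℕ, (∃ τ, IsReducedWordFor v τ) → (∀ i, α (v i) = sortC α i) →
        permLength w ≤ permLength v)
  then piWord h.choose (xExp (sortC α)) else 0

/-- The `φ`-flagged key polynomial `κ_{(α,φ)} = Σ_{T ∈ SSKT(α,φ)} x^{wt(T)}`. -/
def flaggedKeyPoly (α φ : ℕ → ℕ) : MvPolynomial ℕ ℤ :=
  ∑ᶠ T ∈ SSKT α φ, xExp (wtTab T)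

/-! ### Column insertion, keys, standardization -/

/-- The number of boxes in column `c` of a tableau. -/
def colHeightN (T : Tableau) (c : ℕ) : ℕ := Set.ncard {r : ℤ | T r c ≠ 0}

/-- One pass of column insertion: insert the value `x` starting at column `c`
(`fuel` bounds the number of columns visited). -/
def colInsertAux : ℕ → Tableau → ℕ → ℕ → Tableau
  | 0, T, _, _ => T
  | fuel + 1, T, c, x =>
    if ∀ r : ℤ, T r c ≠ 0 → T r c < x then
      -- x is greater than every entry of column c: place it at the end of the column
      fun r c' => if c' = c ∧ r = (colHeightN T c + 1 : ℤ) then x else T r c'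
    else if ∃ r : ℤ, T r c = x then
      -- column c contains x: move on to the next column with the same value
      colInsertAux fuel T (c + 1) x
    else
      -- bump the smallest entry of column c that is larger than x
      let y := sInf {v : ℕ | x < v ∧ ∃ r : ℤ, T r c = v}
      colInsertAux fuel (fun r c' => if c' = c ∧ T r c' = y then x else T r c') (c + 1) y

/-- Column insertion of `x` into the semistandard Young tableau `T`. -/
def colInsert (T : Tableau) (x : ℕ) : Tableau :=
  colInsertAux (sSup {c : ℕ | ∃ r : ℤ, T r c ≠ 0} + 2) T 1 x

/-- The insertion tableau `P` of `(v → ∅)`: successively column insert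
`v_n, v_{n-1}, …, v_1` into the empty tableau. -/
def insertP (v : List ℕ) : Tableau :=
  v.reverse.foldl colInsert (fun _ _ => 0)

/-- The recording tableau `Q` of `(v → ∅)`: the standard Young tableau whose restriction to
`{1, …, j}` has the same shape as the insertion tableau of the last `j` letters of `v`. -/
def insertQ (v : List ℕ) : Tableau := fun r c =>
  sInf {j : ℕ | insertP (v.drop (v.length - j)) r c ≠ 0}

/-- The key `key(α)`: the unique semistandard Young tableau of weight `α` such that the set
of entries of column `i+1` is a subset of the entries of column `i`; its column `c` consists
of the elements of `{x ≥ 1 | α_x ≥ c}` in increasing order from bottom to top. -/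
def keyTab (α : ℕ → ℕ) : Tableau := fun r c =>
  if c = 0 then 0
  else sInf {x : ℕ | 1 ≤ x ∧ c ≤ α x ∧
    ((Set.ncard {y : ℕ | 1 ≤ y ∧ c ≤ α y ∧ y ≤ x} : ℕ) : ℤ) = r}

/-- The standardization of a semistandard Young tableau: the `1`'s are replaced from left to
right by `1, …, β_1`, the `2`'s by `β_1 + 1, …, β_1 + β_2`, and so on. -/
def stdTab (T : Tableau) : Tableau := fun r c =>
  if T r c = 0 then 0
  else Set.ncard {p : ℤ × ℕ |
    T p.1 p.2 ≠ 0 ∧ (T p.1 p.2 < T r c ∨ (T p.1 p.2 = T r c ∧ p.2 ≤ c))}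

/-! ### Maximal factorizations (Reiner–Shimozono) -/

/-- Every block is weakly increasing. -/
def WeaklyIncrFact (g : ℕ → List ℕ) : Prop := ∀ i, List.Chain' (· ≤ ·) (g i)

/-- Maximality: the nonempty blocks have maximal length, i.e. there is a strict descent
between any two consecutive nonempty blocks (no letter can be moved from the end of a block
to the front of the next one to the right). -/
def MaxFact (g : ℕ → List ℕ) : Prop :=
  ∀ i j : ℕ, 1 ≤ i → i < j → g i ≠ [] → g j ≠ [] → (∀ m, i < m → m < j → g m = []) →
    (g i).headI < (g j).getLastD 0

/-- Reiner–Shimozono's set `𝒲(α, φ)` of `φ`-flagged maximal factorizations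
`u^• = u^n ⋯ u^2 u^1` with `ℓ(u^i) = α_i` and `(u → ∅) = (P, std(key(α)))`. -/
def Wset (α φ : ℕ → ℕ) : Set (ℕ → List ℕ) :=
  {g | g 0 = [] ∧ (∀ i, (g i).length = α i) ∧ (∀ i, ∀ x ∈ g i, 1 ≤ x) ∧
       WeaklyIncrFact g ∧ MaxFact g ∧ (∀ i, ∀ x ∈ g i, x ≤ φ i) ∧
       insertQ (factWord g) = stdTab (keyTab α)}

/-! ### Shifts and highest weight key tableaux -/

/-- `shift_N`: add `N` to every letter of every block. -/
def shiftFact (N : ℕ) (f : ℕ → List ℕ) : ℕ → List ℕ := fun i => (f i).map (· + N)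

/-- The tableau of shape `α` whose column `i` is filled by `1, 2, …, λ^T_i` in increasing
order from bottom to top (where `λ^T` is the conjugate of the partition rearrangement `λ`
of `α`): the box of column `c` in row `m` (where `α_m ≥ c`) contains the number of indices
`m' ≤ m` with `α_{m'} ≥ c`. -/
def highKeyTab (α : ℕ → ℕ) : Tableau := fun r c =>
  if c = 0 then 0
  else if ∃ m : ℕ, (m : ℤ) = r ∧ 1 ≤ m ∧ c ≤ α m then
    Set.ncard {m : ℕ | 1 ≤ m ∧ c ≤ α m ∧ (m : ℤ) ≤ r}
  else 0


/-- A `gl_n`-crystal isomorphism between two sets of key tableaux, both equipped with the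
Assaf–Schilling operators (restricted to the sets): a weight-preserving bijection commuting
with all raising and lowering operators `e_i, f_i` for `1 ≤ i < n`. -/
def SSKTIso (n : ℕ) (S₁ S₂ : Set Tableau) : Prop :=
  ∃ g : Tableau → Tableau, Set.BijOn g S₁ S₂ ∧
    (∀ T ∈ S₁, wtTab T = wtTab (g T)) ∧
    ∀ T ∈ S₁, ∀ i : ℕ, 1 ≤ i → i < n →
      Option.map g (restrictOp S₁ (keyE i) T) = restrictOp S₂ (keyE i) (g T) ∧
      Option.map g (restrictOp S₁ (keyF i) T) = restrictOp S₂ (keyF i) (g T)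
/-! ### The pairing of two adjacent blocks -/

lemma find_lt_some {A : List ℕ} (hA : A.Pairwise (· < ·)) {b x : ℕ}
    (h : A.find? (fun a => decide (b < a)) = some x) :
    x ∈ A ∧ b < x ∧ ∀ y ∈ A, b < y → x ≤ y := by
  refine ⟨List.mem_of_find?_eq_some h, by simpa using List.find?_some h, ?_⟩
  obtain ⟨_, u, v, rfl, hu⟩ := List.find?_eq_some_iff_append.1 h
  intro y hy hby
  rcases List.mem_append.1 hy with hy | hy
  · have := hu y hy
    simp at this
    omega
  · rcases List.mem_cons.1 hy with rfl | hy
    · exact le_rfl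
    · exact ((List.pairwise_cons.1 (List.pairwise_append.1 hA).2.1).1 y hy).le

lemma unpairedUpper_cons {A : List ℕ} (hA : A.Pairwise (· < ·)) (b : ℕ) (bs : List ℕ) :
    (unpairedUpper (b :: bs) A = unpairedUpper bs A ∧ ∀ y ∈ A, y ≤ b) ∨
    ∃ x ∈ A, b < x ∧ (∀ y ∈ A, b < y → x ≤ y) ∧
      unpairedUpper (b :: bs) A = unpairedUpper bs (A.erase x) := by
  rcases h : A.find? (fun a => decide (b < a)) with _ | x
  · left
    refine ⟨by simp [unpairedUpper, h], fun y hy => ?_⟩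
    simpa using List.find?_eq_none.1 h y hy
  · right
    obtain ⟨hx, hbx, hmin⟩ := find_lt_some hA h
    exact ⟨x, hx, hbx, hmin, by simp [unpairedUpper, h]⟩

lemma mem_of_mem_unpairedUpper {a : ℕ} (bs : List ℕ) {A : List ℕ} (hA : A.Pairwise (· < ·))
    (h : a ∈ unpairedUpper bs A) : a ∈ A := by
  induction bs generalizing A with
  | nil => exact h
  | cons b bs ih =>
    rcases unpairedUpper_cons hA b bs with ⟨he, _⟩ | ⟨x, _, _, _, he⟩ <;> rw [he] at h
    · exact ih hA h
    · exact List.mem_of_mem_erase (ih (hA.erase x) h)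

/-- An unpaired upper letter is never the partner of a lower letter. -/
lemma ne_of_mem_unpairedUpper_erase {a x : ℕ} {bs A : List ℕ} (hA : A.Pairwise (· < ·))
    (h : a ∈ unpairedUpper bs (A.erase x)) : a ≠ x :=
  ((List.Nodup.mem_erase_iff (hA.imp ne_of_lt)).1
    (mem_of_mem_unpairedUpper bs (hA.erase x) h)).1

lemma pred_notMem_of_mem_unpairedUpper {a b : ℕ} (bs : List ℕ) {A : List ℕ}
    (hA : A.Pairwise (· < ·)) (h : a ∈ unpairedUpper bs A) (hb : b ∈ bs) : b + 1 ≠ a := by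
  induction bs generalizing A with
  | nil => simp at hb
  | cons c bs ih =>
    have haA := mem_of_mem_unpairedUpper _ hA h
    rcases unpairedUpper_cons hA c bs with ⟨he, hle⟩ | ⟨x, hx, hcx, hmin, he⟩ <;> rw [he] at h
    · rcases List.mem_cons.1 hb with rfl | hb
      · have := hle a haA
        omega
      · exact ih hA h hb
    · rcases List.mem_cons.1 hb with rfl | hb
      · have := ne_of_mem_unpairedUpper_erase hA h
        rintro rfl
        have := hmin _ haA (Nat.lt_succ_self b)
        omega
      · exact ih (hA.erase x) h hb

lemma mem_unpairedUpper_of_forall_le {a : ℕ} (bs : List ℕ) {A : List ℕ}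
    (hA : A.Pairwise (· < ·)) (ha : a ∈ A) (hbs : ∀ b ∈ bs, a ≤ b) :
    a ∈ unpairedUpper bs A := by
  induction bs generalizing A with
  | nil => exact ha
  | cons c bs ih =>
    have hbs' : ∀ b ∈ bs, a ≤ b := fun b hb => hbs b (List.mem_cons_of_mem _ hb)
    have hc : a ≤ c := hbs c List.mem_cons_self
    rcases unpairedUpper_cons hA c bs with ⟨he, _⟩ | ⟨x, _, hcx, _, he⟩ <;> rw [he]
    · exact ih hA ha hbs'
    · exact ih (hA.erase x) ((List.mem_erase_of_ne (by omega)).2 ha) hbs'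

/-- Paired letters of the upper block in `(a, t]`, for `a` unpaired, have their partners
in `[a, t)`. -/
lemma countP_le_of_mem_unpairedUpper {a : ℕ} (t : ℕ) (bs : List ℕ) {A : List ℕ}
    (hA : A.Pairwise (· < ·)) (h : a ∈ unpairedUpper bs A) :
    A.countP (fun x => decide (a < x ∧ x ≤ t)) ≤
      (unpairedUpper bs A).countP (fun x => decide (a < x ∧ x ≤ t)) +
        bs.countP (fun x => decide (a ≤ x ∧ x < t)) := by
  induction bs generalizing A with
  | nil => simp [unpairedUpper]
  | cons c bs ih =>
    have haA := mem_of_mem_unpairedUpper _ hA h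
    rcases unpairedUpper_cons hA c bs with ⟨he, _⟩ | ⟨x, hx, hcx, hmin, he⟩ <;> rw [he] at h ⊢
    · have := ih hA h
      rw [List.countP_cons]
      omega
    · have h1 := ih (hA.erase x) h
      have hax := ne_of_mem_unpairedUpper_erase hA h
      have h2 := (List.perm_cons_erase hx).countP_eq (fun x => decide (a < x ∧ x ≤ t))
      rw [List.countP_cons] at h2 ⊢
      have h3 : a < x ∧ x ≤ t → a ≤ c ∧ c < t := by
        rintro ⟨h4, h5⟩
        refine ⟨?_, by omega⟩
        by_contra hac
        have := hmin a haA (by omega)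
        omega
      by_cases h4 : a < x ∧ x ≤ t
      · simp only [h4, h3 h4, and_self, decide_true, if_true] at h2 ⊢
        omega
      · simp only [h4, decide_false, Bool.false_eq_true, if_false] at h2
        omega

lemma Ico_subset_of_mem_unpairedUpper {a s : ℕ} {A B : List ℕ} (hA : A.Pairwise (· < ·))
    (hB : B.Pairwise (· < ·)) (h : a ∈ unpairedUpper B.reverse A)
    (hmax : ∀ x ∈ unpairedUpper B.reverse A, x ≤ a) (hs : ∀ m ≤ s, a + m ∈ A) :
    ∀ m < s, a + m ∈ B := by
  have h1 := countP_le_of_mem_unpairedUpper (a + s) B.reverse hA h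
  have h2 : (unpairedUpper B.reverse A).countP (fun x => decide (a < x ∧ x ≤ a + s)) = 0 := by
    rw [List.countP_eq_zero]
    intro x hx
    have := hmax x hx
    simp
    omega
  have h3 : s ≤ A.countP (fun x => decide (a < x ∧ x ≤ a + s)) := by
    rw [List.countP_eq_length_filter,
      ← List.toFinset_card_of_nodup ((hA.imp ne_of_lt).filter _)]
    have : Finset.Ioc a (a + s) ⊆
        (A.filter (fun x => decide (a < x ∧ x ≤ a + s))).toFinset := by
      intro x hx
      rw [Finset.mem_Ioc] at hx
      have := hs (x - a) (by omega)
      rw [Nat.add_sub_cancel' hx.1.le] at this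
      simp [this, hx]
    simpa using Finset.card_le_card this
  rw [h2, List.countP_reverse, List.countP_eq_length_filter (l := B),
    ← List.toFinset_card_of_nodup ((hB.imp ne_of_lt).filter _)] at h1
  have h4 : (B.filter (fun x => decide (a ≤ x ∧ x < a + s))).toFinset ⊆
      Finset.Ico a (a + s) := by
    intro x hx
    simpa using (by simpa using hx : x ∈ B ∧ a ≤ x ∧ x < a + s).2
  have h5 := Finset.eq_of_subset_of_card_le h4 (by rw [Nat.card_Ico]; omega)
  intro m hm
  have h6 : a + m ∈ Finset.Ico a (a + s) := by simp [hm]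
  rw [← h5] at h6
  exact (by simpa using h6 : a + m ∈ B ∧ _).1

lemma le_foldr_max {x : ℕ} {l : List ℕ} (hx : x ∈ l) : x ≤ l.foldr max 0 := by
  induction l with
  | nil => simp at hx
  | cons y ys ih =>
    rcases List.mem_cons.1 hx with rfl | hx
    · simp
    · exact (ih hx).trans (le_max_right _ _)

lemma foldr_max_mem {l : List ℕ} (hl : l ≠ []) : l.foldr max 0 ∈ l := by
  induction l with
  | nil => exact absurd rfl hl
  | cons y ys ih =>
    by_cases hys : ys = []
    · simp [hys]
    · rw [List.foldr_cons]
      rcases max_choice y (ys.foldr max 0) with h | h <;> rw [h]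
      · exact List.mem_cons_self
      · exact List.mem_cons_of_mem _ (ih hys)

/-- The letters around the one moved by the raising operator in the two blocks. -/
lemma msE_eq_some {j : ℕ} {f g : ℕ → List ℕ} (hA : (f (j + 1)).Pairwise (· < ·))
    (hB : (f j).Pairwise (· < ·)) (h : msE j f = some g) :
    ∃ a s, (∀ m ≤ s, a + m ∈ f (j + 1)) ∧ a + s + 1 ∉ f (j + 1) ∧ (∀ m < s, a + m ∈ f j) ∧
      (∀ b ∈ f j, b + 1 ≠ a) ∧
      g = Function.update (Function.update f (j + 1) ((f (j + 1)).erase a)) j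
        (insAsc (a + s) (f j)) := by
  unfold msE at h
  simp only at h
  split_ifs at h with hL
  generalize hLdef : unpairedUpper (f j).reverse (f (j + 1)) = L at h hL
  have hmax : ∀ x ∈ L, x ≤ L.foldr max 0 := fun x hx => le_foldr_max hx
  have hmem : L.foldr max 0 ∈ L := foldr_max_mem hL
  generalize L.foldr max 0 = a at h hmax hmem
  have hne : {m : ℕ | a + m + 1 ∉ f (j + 1)}.Nonempty := by
    refine ⟨(f (j + 1)).foldr max 0, fun hm => ?_⟩
    have := le_foldr_max hm
    omega
  have hs1 := Nat.sInf_mem hne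
  have hs2 : ∀ m < sInf {m : ℕ | a + m + 1 ∉ f (j + 1)}, a + m + 1 ∈ f (j + 1) := fun m hm => by
    simpa using Nat.notMem_of_lt_sInf hm
  generalize sInf {m : ℕ | a + m + 1 ∉ f (j + 1)} = s at h hs1 hs2
  rw [← hLdef] at hmem hmax
  have hsA : ∀ m ≤ s, a + m ∈ f (j + 1) := by
    rintro (_ | m) hm
    · exact mem_of_mem_unpairedUpper _ hA hmem
    · exact hs2 m hm
  exact ⟨a, s, hsA, hs1, Ico_subset_of_mem_unpairedUpper hA hB hmem hmax hsA,
    fun b hb => pred_notMem_of_mem_unpairedUpper _ hA hmem (List.mem_reverse.2 hb),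
    (Option.some.inj h).symm⟩

lemma mem_insAsc {x y : ℕ} {l : List ℕ} : y ∈ insAsc x l ↔ y = x ∨ y ∈ l := by
  induction l with
  | nil => simp [insAsc]
  | cons z zs ih =>
    unfold insAsc
    split_ifs
    · simp
    · simp [ih]
      tauto

lemma insAsc_append {x : ℕ} {l₁ l₂ : List ℕ} (h₁ : ∀ y ∈ l₁, y < x) (h₂ : ∀ y ∈ l₂, x ≤ y) :
    insAsc x (l₁ ++ l₂) = l₁ ++ x :: l₂ := by
  induction l₁ with
  | nil =>
    cases l₂ with
    | nil => rfl
    | cons z zs => simp [insAsc, h₂ z]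
  | cons z zs ih =>
    have hz : ¬ x ≤ z := by simpa using h₁ z
    simp only [List.cons_append, insAsc, hz, if_false]
    rw [ih fun y hy => h₁ y (List.mem_cons_of_mem _ hy)]

/-! ### Invariance of reduced words -/

lemma wordPerm_append (u v : List ℕ) : wordPerm (u ++ v) = wordPerm u * wordPerm v := by
  simp [wordPerm]

lemma sPerm_mul_self (k : ℕ) : sPerm k * sPerm k = 1 := Equiv.swap_mul_self _ _

lemma sPerm_commute {x y : ℕ} (h : x + 2 ≤ y) : Commute (sPerm x) (sPerm y) := by
  apply Equiv.Perm.Disjoint.commute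
  intro z
  by_cases hz : z = x ∨ z = x + 1
  · right
    exact Equiv.swap_apply_of_ne_of_ne (by omega) (by omega)
  · left
    exact Equiv.swap_apply_of_ne_of_ne (by omega) (by omega)

lemma sPerm_braid (k : ℕ) :
    sPerm k * sPerm (k + 1) * sPerm k = sPerm (k + 1) * sPerm k * sPerm (k + 1) := by
  have h1 := Equiv.swap_mul_swap_mul_swap (x := k + 2) (y := k + 1) (z := k)
    (by omega) (by omega)
  have h2 := Equiv.swap_mul_swap_mul_swap (x := k) (y := k + 1) (z := k + 2)
    (by omega) (by omega)
  rw [Equiv.swap_comm (k + 1) k, Equiv.swap_comm (k + 2) (k + 1)] at h1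
  rw [Equiv.swap_comm (k + 2) k] at h2
  exact h1.trans h2.symm

lemma wordPerm_commute {u v : List ℕ} (h : ∀ x ∈ u, ∀ y ∈ v, x + 2 ≤ y) :
    Commute (wordPerm u) (wordPerm v) := by
  apply Commute.list_prod_left
  intro p hp
  apply Commute.list_prod_right
  intro q hq
  obtain ⟨x, hx, rfl⟩ := List.mem_map.1 hp
  obtain ⟨y, hy, rfl⟩ := List.mem_map.1 hq
  exact sPerm_commute (h x hx y hy)

lemma wordPerm_range'_succ (a s : ℕ) :
    wordPerm (List.range' a (s + 1)) = wordPerm (List.range' a s) * sPerm (a + s) := by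
  rw [List.range'_concat, wordPerm_append]
  simp [wordPerm]

lemma wordPerm_range'_mul (a s : ℕ) :
    wordPerm (List.range' a (s + 1)) * wordPerm (List.range' a s) =
      wordPerm (List.range' (a + 1) s) * wordPerm (List.range' a (s + 1)) := by
  induction s with
  | zero => simp [wordPerm]
  | succ s ih =>
    have hc : Commute (wordPerm (List.range' a s)) (sPerm (a + s + 1)) := by
      have := wordPerm_commute (u := List.range' a s) (v := [a + s + 1]) (by
        intro x hx y hy
        rw [List.mem_range'_1] at hx
        simp at hy
        omega)
      simpa [wordPerm] using this
    have h1 := wordPerm_range'_succ a (s + 1)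
    have h2 := wordPerm_range'_succ a s
    have h3 := wordPerm_range'_succ (a + 1) s
    have hb := sPerm_braid (a + s)
    rw [show a + 1 + s = a + s + 1 by ring] at h3
    rw [← add_assoc] at h1
    generalize wordPerm (List.range' a s) = P at *
    generalize wordPerm (List.range' a (s + 1)) = Q at *
    generalize wordPerm (List.range' a (s + 1 + 1)) = R at *
    generalize wordPerm (List.range' (a + 1) s) = P' at *
    generalize wordPerm (List.range' (a + 1) (s + 1)) = Q' at *
    generalize sPerm (a + s + 1) = t at *
    generalize sPerm (a + s) = r at *
    calc R * Q = Q * (t * P) * r := by rw [h1, h2]; group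
      _ = (Q * P) * (t * r) := by rw [← hc.eq]; group
      _ = P' * P * (r * t * r) := by rw [ih, h2]; group
      _ = P' * (P * t) * r * t := by rw [hb]; group
      _ = Q' * R := by rw [hc.eq, h1, h2, h3]; group

lemma wordPerm_range'_mul_self (a s : ℕ) :
    wordPerm (List.range' a (s + 1)) * wordPerm (List.range' a (s + 1)) =
      wordPerm (List.range' (a + 1) s) * wordPerm (List.range' a s) := by
  conv_lhs => rw [wordPerm_range'_succ a s, ← mul_assoc, ← wordPerm_range'_succ,
    wordPerm_range'_mul, wordPerm_range'_succ, mul_assoc, mul_assoc, sPerm_mul_self, mul_one]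

lemma exists_eq_append_range' {l : List ℕ} (hl : l.Pairwise (· < ·)) {a s : ℕ}
    (h : ∀ m < s, a + m ∈ l) :
    ∃ l₁ l₂, l = l₁ ++ (List.range' a s ++ l₂) ∧ (∀ x ∈ l₁, x < a) ∧ ∀ x ∈ l₂, a + s ≤ x := by
  refine ⟨l.filter (· < a), l.filter (a + s ≤ ·), ?_, by simp, by simp⟩
  refine List.Pairwise.eq_of_mem_iff hl ?_ fun x => ?_
  · simp only [List.pairwise_append]
    refine ⟨hl.filter _, ⟨List.pairwise_lt_range', hl.filter _, ?_⟩, ?_⟩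
    · intro x hx y hy
      rw [List.mem_range'_1] at hx
      simp at hy
      omega
    · intro x hx y hy
      simp at hx hy
      omega
  · simp only [List.mem_append, List.mem_filter, List.mem_range'_1, decide_eq_true_eq]
    constructor
    · intro hx
      by_cases h1 : x < a
      · exact Or.inl ⟨hx, h1⟩
      · by_cases h2 : x < a + s
        · exact Or.inr (Or.inl ⟨by omega, h2⟩)
        · exact Or.inr (Or.inr ⟨hx, by omega⟩)
    · rintro (hx | hx | hx)
      · exact hx.1
      · have := h (x - a) (by omega)
        rwa [Nat.add_sub_cancel' hx.1] at this
      · exact hx.1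

lemma pairwise_insAsc {x : ℕ} {l : List ℕ} (hl : l.Pairwise (· < ·)) (hx : x ∉ l) :
    (insAsc x l).Pairwise (· < ·) := by
  induction l with
  | nil => simp [insAsc]
  | cons z zs ih =>
    have hz := List.pairwise_cons.1 hl
    rw [List.mem_cons, not_or] at hx
    unfold insAsc
    split_ifs with h
    · refine List.pairwise_cons.2 ⟨fun y hy => ?_, hl⟩
      rcases List.mem_cons.1 hy with rfl | hy
      · omega
      · have := hz.1 y hy
        omega
    · refine List.pairwise_cons.2 ⟨fun y hy => ?_, ih hz.2 hx.2⟩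
      rcases mem_insAsc.1 hy with rfl | hy
      · omega
      · exact hz.1 y hy

/-- Two factors of a word with letters in `[a, t]`, separated only by letters commuting with
the relevant factors, may be replaced by factors with the same product. -/
lemma wordPerm_replace {a t : ℕ} {A₂ B₁ M N M' N' : List ℕ} (U A₁ B₂ V : List ℕ)
    (hat : a ≤ t) (hA₂ : ∀ x ∈ A₂, t + 2 ≤ x) (hB₁ : ∀ x ∈ B₁, x + 2 ≤ a)
    (hM : ∀ x ∈ M, a ≤ x ∧ x ≤ t) (hN : ∀ x ∈ N, a ≤ x ∧ x ≤ t)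
    (hM' : ∀ x ∈ M', a ≤ x ∧ x ≤ t) (hN' : ∀ x ∈ N', a ≤ x ∧ x ≤ t)
    (h : wordPerm M * wordPerm N = wordPerm M' * wordPerm N') :
    wordPerm (U ++ ((A₁ ++ (M ++ A₂)) ++ ((B₁ ++ (N ++ B₂)) ++ V))) =
      wordPerm (U ++ ((A₁ ++ (M' ++ A₂)) ++ ((B₁ ++ (N' ++ B₂)) ++ V))) := by
  have sandwich : ∀ M N : List ℕ, (∀ x ∈ M, a ≤ x ∧ x ≤ t) → (∀ x ∈ N, a ≤ x ∧ x ≤ t) →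
      wordPerm M * (wordPerm A₂ * (wordPerm B₁ * wordPerm N)) =
        wordPerm B₁ * (wordPerm M * wordPerm N) * wordPerm A₂ := by
    intro M N hM hN
    have c1 : Commute (wordPerm (B₁ ++ N)) (wordPerm A₂) := wordPerm_commute fun x hx y hy => by
      have h2 := hA₂ y hy
      rcases List.mem_append.1 hx with hx | hx
      · have := hB₁ x hx
        omega
      · have := hN x hx
        omega
    have c2 : Commute (wordPerm B₁) (wordPerm M) := wordPerm_commute fun x hx y hy =>
      (hB₁ x hx).trans (hM y hy).1
    rw [← wordPerm_append, ← c1.eq, wordPerm_append]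
    simp only [← mul_assoc]
    rw [c2.eq]
  simp only [wordPerm_append, mul_assoc]
  have h1 := sandwich M N hM hN
  have h2 := sandwich M' N' hM' hN'
  rw [← h, ← h1] at h2
  have h3 := congrArg (fun p => wordPerm U * wordPerm A₁ * p * (wordPerm B₂ * wordPerm V)) h2
  simpa only [mul_assoc] using h3.symm

/-- A raising move on two adjacent increasing factors of a reduced word yields a reduced word
for the same permutation, with both factors still increasing. -/
lemma isReducedWordFor_raise {w : Equiv.Perm ℕ} {U A B V : List ℕ}
    (hA : A.Pairwise (· < ·)) (hB : B.Pairwise (· < ·))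
    (hw : IsReducedWordFor w (U ++ (A ++ (B ++ V)))) {a s : ℕ}
    (hsA : ∀ m ≤ s, a + m ∈ A) (hsA' : a + s + 1 ∉ A) (hsB : ∀ m < s, a + m ∈ B)
    (hB' : ∀ b ∈ B, b + 1 ≠ a) :
    (insAsc (a + s) B).Pairwise (· < ·) ∧
      IsReducedWordFor w (U ++ (A.erase a ++ (insAsc (a + s) B ++ V))) := by
  obtain ⟨A₁, A₂, hAeq, hA₁, hA₂⟩ := exists_eq_append_range' hA
    (fun m hm => hsA m (Nat.lt_succ_iff.1 hm))
  obtain ⟨B₁, B₂, hBeq, hB₁, hB₂⟩ := exists_eq_append_range' hB hsB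
  have hB₁' : ∀ x ∈ B₁, x + 2 ≤ a := fun x hx => by
    have h1 := hB₁ x hx
    have h2 := hB' x (by simp [hBeq, hx])
    omega
  have hA₂' : ∀ x ∈ A₂, a + s + 2 ≤ x := fun x hx => by
    have h1 := hA₂ x hx
    have h2 : x ≠ a + s + 1 := by
      rintro rfl
      exact hsA' (by simp [hAeq, hx])
    omega
  obtain ⟨⟨hpos, hmin⟩, rfl⟩ := hw
  have hnot : a + s ∉ B := by
    intro hmem
    obtain ⟨C₁, C₂, hCeq, hC₁, -⟩ := exists_eq_append_range' hB (a := a) (s := s + 1)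
      (fun m hm => by
        rcases Nat.lt_succ_iff_lt_or_eq.1 hm with h | rfl
        · exact hsB m h
        · exact hmem)
    have hC₁' : ∀ x ∈ C₁, x + 2 ≤ a := fun x hx => by
      have h1 := hC₁ x hx
      have h2 := hB' x (by simp [hCeq, hx])
      omega
    have hperm := wordPerm_replace U A₁ C₂ V (Nat.le_add_right a s) hA₂' hC₁'
      (M := List.range' a (s + 1)) (N := List.range' a (s + 1))
      (M' := List.range' (a + 1) s) (N' := List.range' a s)
      (by simp; omega) (by simp; omega) (by simp; omega) (by simp; omega)
      (wordPerm_range'_mul_self a s)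
    rw [hAeq, hCeq] at hpos hmin
    have := hmin _ (fun x hx => hpos x ?_) hperm.symm
    · simp at this
      omega
    · simp only [List.mem_append, List.mem_range'_1] at hx ⊢
      have h1 : a + 1 ≤ x ∧ x < a + 1 + s → a ≤ x ∧ x < a + (s + 1) := by omega
      have h2 : a ≤ x ∧ x < a + s → a ≤ x ∧ x < a + (s + 1) := by omega
      tauto
  have hins : insAsc (a + s) B = B₁ ++ (List.range' a (s + 1) ++ B₂) := by
    rw [hBeq, ← List.append_assoc, insAsc_append _ hB₂, List.range'_concat]
    · simp
    · intro y hy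
      rcases List.mem_append.1 hy with hy | hy
      · have := hB₁ y hy
        omega
      · rw [List.mem_range'_1] at hy
        omega
  have herase : A.erase a = A₁ ++ (List.range' (a + 1) s ++ A₂) := by
    rw [hAeq, List.erase_append_right _ (fun h => lt_irrefl _ (hA₁ a h)), List.range'_succ]
    simp
  have hperm := wordPerm_replace U A₁ B₂ V (Nat.le_add_right a s) hA₂' hB₁'
    (M := List.range' a (s + 1)) (N := List.range' a s)
    (M' := List.range' (a + 1) s) (N' := List.range' a (s + 1)) 
    (by simp; omega) (by simp; omega) (by simp; omega) (by simp; omega)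
    (wordPerm_range'_mul a s)
  refine ⟨pairwise_insAsc hB hnot, ?_⟩
  rw [hins, herase]
  rw [hAeq, hBeq] at hpos hmin ⊢
  refine ⟨⟨?_, fun σ hσ hσw => ?_⟩, hperm.symm⟩
  · intro x hx
    apply hpos x
    simp only [List.mem_append, List.mem_range'_1] at hx ⊢
    have : a + 1 ≤ x ∧ x < a + 1 + s → a ≤ x ∧ x < a + (s + 1) := by omega
    tauto
  · rw [← hperm] at hσw
    have := hmin σ hσ hσw
    simp at this ⊢
    omega

/-! ### The word of a factorization -/

/-- The concatenation `f n ⋯ f 1 f 0` of the first blocks of a factorization. -/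
def blockWord (f : ℕ → List ℕ) : ℕ → List ℕ
  | 0 => f 0
  | m + 1 => f (m + 1) ++ blockWord f m

lemma factWord_eq_blockWord {n : ℕ} {f : ℕ → List ℕ} (hf : ∀ k, n < k → f k = []) :
    factWord f = blockWord f n := by
  have h1 : ∀ m, ((List.range (m + 1)).reverse.map f).foldr (· ++ ·) [] = blockWord f m := by
    intro m
    induction m with
    | zero => simp [blockWord]
    | succ m ih =>
      rw [List.range_succ, List.reverse_append, List.map_append]
      simpa [blockWord] using ih
  have hbdd : n ∈ upperBounds {k : ℕ | f k ≠ []} := fun k hk => by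
    by_contra h
    exact hk (hf k (by omega))
  have htop : ∀ k, topIdx f < k → f k = [] := fun k hk => by
    by_contra h
    exact absurd (le_csSup ⟨n, hbdd⟩ h) (not_le.2 hk)
  have hle : topIdx f ≤ n := csSup_le' hbdd
  have h2 : factWord f = blockWord f (topIdx f) := by
    simp [← h1, factWord, factWordGe]
  rw [h2]
  clear h1 h2 hbdd hf
  induction n, hle using Nat.le_induction with
  | base => rfl
  | succ m hm ih => rw [blockWord, htop (m + 1) (by omega), ← ih, List.nil_append]

lemma mem_blockWord {f : ℕ → List ℕ} {n k x : ℕ} (hk : k ≤ n) (hx : x ∈ f k) :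
    x ∈ blockWord f n := by
  induction n with
  | zero =>
    obtain rfl : k = 0 := by omega
    exact hx
  | succ n ih =>
    rw [blockWord, List.mem_append]
    rcases hk.lt_or_eq with h | rfl
    · exact Or.inr (ih (by omega))
    · exact Or.inl hx

/-- Factorizations agreeing outside blocks `j` and `j + 1` have words agreeing outside these. -/
lemma blockWord_eq_append {f g : ℕ → List ℕ} {j n : ℕ} (hj : 1 ≤ j) (hjn : j < n)
    (hfg : ∀ k, k ≠ j → k ≠ j + 1 → f k = g k) :
    ∃ U V, blockWord f n = U ++ (f (j + 1) ++ (f j ++ V)) ∧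
      blockWord g n = U ++ (g (j + 1) ++ (g j ++ V)) := by
  induction n, hjn using Nat.le_induction with
  | base =>
    obtain ⟨j, rfl⟩ : ∃ l, j = l + 1 := ⟨j - 1, by omega⟩
    refine ⟨[], blockWord f j, rfl, ?_⟩
    have : ∀ m ≤ j, blockWord f m = blockWord g m := by
      intro m hm
      induction m with
      | zero => exact hfg 0 (by omega) (by omega)
      | succ m ih => rw [blockWord, blockWord, hfg _ (by omega) (by omega), ih (by omega)]
    rw [this j le_rfl]
    rfl
  | succ m hm ih =>
    obtain ⟨U, V, h1, h2⟩ := ih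
    refine ⟨f (m + 1) ++ U, V, ?_, ?_⟩
    · rw [blockWord, h1, List.append_assoc]
    · rw [blockWord, h2, ← hfg (m + 1) (by omega) (by omega), List.append_assoc]

lemma IncreasingFact.pairwise {f : ℕ → List ℕ} (hf : IncreasingFact f) (k : ℕ) :
    (f k).Pairwise (· < ·) :=
  List.isChain_iff_pairwise.1 (hf k)

lemma pos_of_mem_RFn {w : Equiv.Perm ℕ} {n : ℕ} {f : ℕ → List ℕ} (hf : f ∈ RFn n w) {k x : ℕ}
    (hx : x ∈ f k) : 1 ≤ x := by
  obtain ⟨_, hn, _, ⟨hpos, _⟩, _⟩ := hf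
  rw [factWord_eq_blockWord hn] at hpos
  refine hpos x (mem_blockWord ?_ hx)
  by_contra h
  simp [hn k (by omega)] at hx

lemma flaggedFact_iff {w : Equiv.Perm ℕ} {n : ℕ} {f : ℕ → List ℕ} (hf : f ∈ RFn n w)
    {φ : ℕ → ℕ} (hφ : IsFlag φ) : FlaggedFact φ f ↔ ∀ k, ∀ x ∈ f k, k ≤ φ x := by
  constructor
  · intro h k x hx
    have h1 := h k (List.ne_nil_of_mem hx)
    have hp := hf.2.2.1.pairwise k
    have hpos : ∀ y ∈ f k, 1 ≤ y := fun y hy => pos_of_mem_RFn hf hy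
    rcases hfk : f k with _ | ⟨y, ys⟩ <;> rw [hfk] at hx h1 hp hpos
    · simp at hx
    · refine h1.trans (hφ.1 _ _ (hpos y List.mem_cons_self) ?_)
      rcases List.mem_cons.1 hx with rfl | hx
      · exact le_rfl
      · exact ((List.pairwise_cons.1 hp).1 x hx).le
  · intro h k hk
    apply h k
    rcases hfk : f k with _ | ⟨y, ys⟩
    · exact absurd hfk hk
    · exact List.mem_cons_self

/-- The raising operator preserves the crystal `RF_n(w)`. -/
lemma msE_mem_RFn {w : Equiv.Perm ℕ} {n j : ℕ} (hj : 1 ≤ j) (hjn : j < n) {f g : ℕ → List ℕ}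
    (hf : f ∈ RFn n w) (h : msE j f = some g) : g ∈ RFn n w := by
  have ⟨h0, hn, hinc, hw⟩ := hf
  have hA := hinc.pairwise (j + 1)
  have hB := hinc.pairwise j
  obtain ⟨a, s, hsA, hsA', hsB, hB', rfl⟩ := msE_eq_some hA hB h
  set g := Function.update (Function.update f (j + 1) ((f (j + 1)).erase a)) j
    (insAsc (a + s) (f j)) with hg
  have hgj : g j = insAsc (a + s) (f j) := by simp [hg]
  have hgj' : g (j + 1) = (f (j + 1)).erase a := by simp [hg]
  have hfg : ∀ k, k ≠ j → k ≠ j + 1 → f k = g k := fun k h1 h2 => by simp [hg, h1, h2]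
  have hgn : ∀ k, n < k → g k = [] := fun k hk => by
    rw [← hfg k (by omega) (by omega), hn k hk]
  obtain ⟨U, V, hU, hV⟩ := blockWord_eq_append hj hjn hfg
  rw [factWord_eq_blockWord hn, hU] at hw
  obtain ⟨hins, hw'⟩ := isReducedWordFor_raise hA hB hw hsA hsA' hsB hB'
  refine ⟨(hfg 0 (by omega) (by omega)).symm.trans h0, hgn, fun k => ?_, ?_⟩
  · refine List.isChain_iff_pairwise.2 ?_
    by_cases h1 : k = j
    · rw [h1, hgj]
      exact hins
    · by_cases h2 : k = j + 1
      · rw [h2, hgj']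
        exact hA.erase a
      · rw [← hfg k h1 h2]
        exact hinc.pairwise k
  · rw [factWord_eq_blockWord hgn, hV, hgj, hgj']
    exact hw'

/-! ### Flags and raising -/

lemma flagged_of_msEIter {w : Equiv.Perm ℕ} {n j : ℕ} (hj : 1 ≤ j) (hjn : j < n) {φ : ℕ → ℕ}
    (hjφ : ∀ x, 1 ≤ x → j ≤ φ x → j + 1 ≤ φ x) (k : ℕ) {f g : ℕ → List ℕ} (hf : f ∈ RFn n w)
    (h : msEIter j k f = some g) (hg : ∀ k, ∀ x ∈ g k, k ≤ φ x) :
    ∀ k, ∀ x ∈ f k, k ≤ φ x := by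
  induction k generalizing f with
  | zero =>
    obtain rfl : f = g := Option.some.inj h
    exact hg
  | succ k ih =>
    obtain ⟨f', hf', h'⟩ := Option.bind_eq_some_iff.1 h
    have hfl := ih (msE_mem_RFn hj hjn hf hf') h'
    obtain ⟨a, s, hsA, _, hsB, _, rfl⟩ :=
      msE_eq_some (hf.2.2.1.pairwise (j + 1)) (hf.2.2.1.pairwise j) hf'
    have hflj := hfl j
    simp only [Function.update_self, mem_insAsc] at hflj
    intro l x hx
    by_cases h1 : l = j
    · subst h1
      exact hflj x (Or.inr hx)
    · by_cases h2 : l = j + 1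
      · subst h2
        by_cases hxa : x = a
        · subst hxa
          refine hjφ x (pos_of_mem_RFn hf hx) (hflj x ?_)
          rcases Nat.eq_zero_or_pos s with rfl | hs
          · exact Or.inl rfl
          · exact Or.inr (hsB 0 hs)
        · have := hfl (j + 1) x
          simp only [ne_eq, h1, not_false_eq_true, Function.update_of_ne,
            Function.update_self] at this
          exact this ((List.mem_erase_of_ne hxa).2 hx)
      · have := hfl l x
        simp only [ne_eq, h1, h2, not_false_eq_true, Function.update_of_ne] at this
        exact this hx

/-- Raising as long as possible keeps a factorization flagged, and ends in a factorization all of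
whose letters in block `j + 1` are paired. -/
lemma exists_msEIter_of_flagged {w : Equiv.Perm ℕ} {n j : ℕ} (hj : 1 ≤ j) (hjn : j < n)
    {φ : ℕ → ℕ} (hφ : IsFlag φ) {f : ℕ → List ℕ} (hf : f ∈ RFn n w)
    (hfl : ∀ k, ∀ x ∈ f k, k ≤ φ x) :
    ∃ k g, msEIter j k f = some g ∧ g ∈ RFn n w ∧ (∀ k, ∀ x ∈ g k, k ≤ φ x) ∧
      unpairedUpper (g j).reverse (g (j + 1)) = [] := by
  generalize hN : (f (j + 1)).length = N
  induction N using Nat.strong_induction_on generalizing f with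
  | _ N ih =>
    rcases hE : msE j f with _ | f'
    · refine ⟨0, f, rfl, hf, hfl, ?_⟩
      by_contra h
      simp [msE, h] at hE
    · have hf' := msE_mem_RFn hj hjn hf hE
      obtain ⟨a, s, hsA, _, hsB, _, heq⟩ :=
        msE_eq_some (hf.2.2.1.pairwise (j + 1)) (hf.2.2.1.pairwise j) hE
      have haA : a ∈ f (j + 1) := hsA 0 (Nat.zero_le _)
      have hj1 : f' (j + 1) = (f (j + 1)).erase a := by simp [heq]
      have hlen := List.length_erase_of_mem haA
      have hlen' := List.length_pos_of_mem haA
      obtain ⟨k, g, hk, hg⟩ := ih (f' (j + 1)).length (by rw [hj1]; omega) hf' (by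
        intro l x hx
        by_cases h1 : l = j
        · subst h1
          have hx' : x = a + s ∨ x ∈ f l := by simpa [heq, mem_insAsc] using hx
          rcases hx' with rfl | hx'
          · have h2 := hfl _ a haA
            have h3 := hφ.1 a (a + s) (pos_of_mem_RFn hf haA) (Nat.le_add_right _ _)
            omega
          · exact hfl l x hx'
        · by_cases h2 : l = j + 1
          · subst h2
            rw [hj1] at hx
            exact hfl _ x (List.mem_of_mem_erase hx)
          · exact hfl l x (by simpa [heq, h1, h2] using hx)) rfl
      exact ⟨k + 1, g, by simpa [msEIter, hE] using hk, hg⟩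

/-- Theorem `thm 44`.
Let `φ` be a non-standard flag, `i` the smallest positive integer with `φ(i) > i`, and
`j = φ(i) - 1`.  If `i > n` or `j ≥ n` then `RFC_n(w, φ) = RFC_n(w, φ - e_i)`;
otherwise `RFC_n(w, φ) = 𝔇_j RFC_n(w, φ - e_i)`. -/
theorem RFCn_demazure_recursion (w : Equiv.Perm ℕ) (hw : FinitaryPerm w) (n : ℕ)
    (hn : 1 ≤ n) (φ : ℕ → ℕ) (hφ : IsFlag φ)
    (i : ℕ) (hi1 : 1 ≤ i) (hi2 : i < φ i) (hmin : ∀ m, 1 ≤ m → m < φ m → i ≤ m)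
    (j : ℕ) (hj : j = φ i - 1) :
    ((n < i ∨ n ≤ j) → RFCn n w φ = RFCn n w (subE φ i)) ∧
    (i ≤ n → j < n → RFCn n w φ = demOp n w j (RFCn n w (subE φ i))) := by
  have hlow : ∀ x, 1 ≤ x → x < i → φ x = x := fun x hx hxi => by
    by_contra h
    have := hmin x hx (lt_of_le_of_ne (hφ.2 x hx) (Ne.symm h))
    omega
  have hhigh : ∀ x, i ≤ x → j + 1 ≤ φ x := fun x hx => by
    have := hφ.1 i x hi1 hx
    omega
  have hle : ∀ x, subE φ i x ≤ φ x := fun x => by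
    unfold subE
    split_ifs <;> omega
  have hsub : ∀ x, x ≠ i → subE φ i x = φ x := fun x hx => if_neg hx
  have hsub_self : subE φ i i = j := by simp [subE, hj]
  have hsubset : RFCn n w (subE φ i) ⊆ RFCn n w φ := fun f hf =>
    ⟨hf.1, fun k hk => (hf.2 k hk).trans (hle _)⟩
  constructor
  · intro hnj
    refine Set.Subset.antisymm (fun f hf => ⟨hf.1, fun k hk => ?_⟩) hsubset
    have h1 := hf.2 k hk
    have h2 : k ≤ n := by
      by_contra h
      exact hk (hf.1.2.1 k (by omega))
    by_cases h : (f k).headI = i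
    · rw [h, hsub_self]
      omega
    · rwa [hsub _ h]
  · intro _ hjn
    have hj1 : 1 ≤ j := by omega
    have hge : ∀ x, 1 ≤ x → j ≤ φ x → i ≤ x := fun x hx h => by
      by_contra hxi
      have := hlow x hx (by omega)
      omega
    have hsubflag : IsFlag (subE φ i) := by
      refine ⟨fun a b ha hab => ?_, fun a ha => ?_⟩
      · by_cases hb : b = i
        · subst hb
          by_cases hai : a = b
          · rw [hai]
          · rw [hsub a hai, hsub_self, hlow a ha (by omega)]
            omega
        · rw [hsub b hb]
          exact (hle a).trans (hφ.1 a b ha hab)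
      · by_cases hai : a = i
        · rw [hai, hsub_self]
          omega
        · rw [hsub a hai]
          exact hφ.2 a ha
    apply Set.Subset.antisymm
    · intro f hf
      obtain ⟨k, g, hk, hg, hgfl, hpaired⟩ :=
        exists_msEIter_of_flagged hj1 hjn hφ hf.1 ((flaggedFact_iff hf.1 hφ).1 hf.2)
      refine ⟨hf.1, k, g, hk, hg, (flaggedFact_iff hg hsubflag).2 fun l x hx => ?_⟩
      have hlx := hgfl l x hx
      by_cases hxi : x = i
      · subst hxi
        rw [hsub_self]
        by_contra hl
        obtain rfl : l = j + 1 := by omega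
        have := mem_unpairedUpper_of_forall_le (g j).reverse (hg.2.2.1.pairwise (j + 1)) hx
          fun b hb => by
            rw [List.mem_reverse] at hb
            exact hge b (pos_of_mem_RFn hg hb) (hgfl j b hb)
        simp [hpaired] at this
      · rwa [hsub x hxi]
    · rintro f ⟨hf, k, g, hk, hg⟩
      refine ⟨hf, (flaggedFact_iff hf hφ).2 (flagged_of_msEIter hj1 hjn
        (fun x hx h => hhigh x (hge x hx h)) k hf hk ?_)⟩
      exact (flaggedFact_iff hg.1 hφ).1 (hsubset hg).2

end
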